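/- arXiv:0904.0833 — 2 statements merged into one kernel-verified Lean document; each statement's English description precedes it below -/
import Mathlib

section
/- If h : [-1,1] → ℝ has bounded variation V(h) and upper bound U(|h|), and H(t) = H(-1) + ∫_{-1}^t h(s) ds, then the Legendre spectral coefficients a_n of H satisfy |a_n| ≤ (6/√π)(U + V) · n^{-3/2} for all n ≥ 1. -/
open Set Polynomial

/-- The `n`-th Legendre polynomial, via the Rodrigues formula. -/
noncomputable def legendreP (n : ℕ) : Polynomial ℝ :=
  Polynomial.C (1 / ((2 : ℝ) ^ n * n.factorial)) *
    Polynomial.derivative^[n] ((Polynomial.X ^ 2 - 1) ^ n)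

/-- The `n`-th Legendre spectral coefficient of a function `H` on `[-1,1]`. -/
noncomputable def legendreCoeff (H : ℝ → ℝ) (n : ℕ) : ℝ :=
  ((n : ℝ) + 1 / 2) * ∫ t in (-1 : ℝ)..1, H t * (legendreP n).eval t

section

open MeasureTheory

theorem two_mul_add_one_mul_centralBinom_sq_le (k : ℕ) :
    (2 * k + 1) * k.centralBinom ^ 2 ≤ 16 ^ k := by
  induction k with
  | zero => simp
  | succ k ih =>
    have h := Nat.succ_mul_centralBinom_succ k
    refine Nat.le_of_mul_le_mul_left (c := (k + 1) ^ 2) ?_ (by positivity)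
    calc (k + 1) ^ 2 * ((2 * (k + 1) + 1) * (k + 1).centralBinom ^ 2)
        = (2 * k + 3) * ((k + 1) * (k + 1).centralBinom) ^ 2 := by ring
      _ = 4 * (2 * k + 3) * (2 * k + 1) * ((2 * k + 1) * k.centralBinom ^ 2) := by rw [h]; ring
      _ ≤ 4 * (2 * k + 3) * (2 * k + 1) * 16 ^ k := by gcongr
      _ ≤ (k + 1) ^ 2 * 16 ^ (k + 1) := by
        rw [show (k + 1) ^ 2 * 16 ^ (k + 1) = 16 * (k + 1) ^ 2 * 16 ^ k by ring]
        exact Nat.mul_le_mul_right _ (by nlinarith)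

theorem coeff_X_sq_sub_one_pow (n m : ℕ) :
    ((X ^ 2 - 1 : ℝ[X]) ^ n).coeff m =
      if 2 ∣ m then (-1) ^ (n - m / 2) * (n.choose (m / 2) : ℝ) else 0 := by
  have h : (X ^ 2 - 1 : ℝ[X]) ^ n = expand ℝ 2 ((X - C 1) ^ n) := by simp
  rw [h, coeff_expand two_pos]
  split_ifs
  · rw [sub_eq_add_neg, ← C_neg, coeff_X_add_C_pow]
  · rfl

theorem eval_zero_legendreP (n : ℕ) :
    (legendreP n).eval 0 = ((X ^ 2 - 1 : ℝ[X]) ^ n).coeff n / 2 ^ n := by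
  rw [← coeff_zero_eq_eval_zero, legendreP, coeff_C_mul, coeff_iterate_derivative, zero_add,
    Nat.descFactorial_self, nsmul_eq_mul]
  field_simp

theorem eval_zero_derivative_legendreP (n : ℕ) :
    (derivative (legendreP n)).eval 0 =
      (n + 1) * ((X ^ 2 - 1 : ℝ[X]) ^ n).coeff (n + 1) / 2 ^ n := by
  have h : (1 + n).descFactorial n = (n + 1) * n.factorial := by
    rw [Nat.descFactorial_eq_div (by lia), Nat.add_sub_cancel, Nat.factorial_one, Nat.div_one,
      add_comm, Nat.factorial_succ]
  rw [← coeff_zero_eq_eval_zero, coeff_derivative, legendreP, coeff_C_mul, coeff_iterate_derivative,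
    zero_add, h, nsmul_eq_mul, add_comm 1 n]
  push_cast
  field_simp
  ring

theorem legendreP_energy_zero_le (n : ℕ) (hn : 1 ≤ n) :
    (derivative (legendreP n)).eval 0 ^ 2 + n * (n + 1) * (legendreP n).eval 0 ^ 2 ≤ n := by
  rw [eval_zero_legendreP, eval_zero_derivative_legendreP, coeff_X_sq_sub_one_pow,
    coeff_X_sq_sub_one_pow]
  obtain ⟨k, rfl | rfl⟩ := n.even_or_odd'
  · have h : (2 * (k : ℝ) + 1) * (k.centralBinom : ℝ) ^ 2 ≤ 16 ^ k := by
      exact_mod_cast two_mul_add_one_mul_centralBinom_sq_le k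
    rw [if_neg (by lia), if_pos (by lia), Nat.mul_div_cancel_left _ two_pos,
      ← Nat.centralBinom_eq_two_mul_choose]
    have h4 : ((2 : ℝ) ^ (2 * k)) ^ 2 = 16 ^ k := by
      rw [← pow_mul, mul_comm, mul_comm 2 k, ← mul_assoc, mul_comm, pow_mul, pow_mul]; norm_num
    have h1 : ((-1 : ℝ) ^ (2 * k - k)) ^ 2 = 1 := by
      rw [← pow_mul, mul_comm, pow_mul]; norm_num
    rw [div_pow _ _ 2, div_pow _ _ 2, h4, mul_pow, mul_pow, h1]
    push_cast
    have : (0 : ℝ) < 16 ^ k := by positivity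
    norm_num
    rw [mul_div_assoc', div_le_iff₀ this]
    nlinarith [mul_le_mul_of_nonneg_left h (by positivity : (0 : ℝ) ≤ 2 * k)]
  · have h : (2 * (k : ℝ) + 1) * (k.centralBinom : ℝ) ^ 2 ≤ 16 ^ k := by
      exact_mod_cast two_mul_add_one_mul_centralBinom_sq_le k
    have hc : ((k : ℝ) + 1) * ((2 * k + 1).choose (k + 1) : ℝ) = (2 * k + 1) * k.centralBinom := by
      have := Nat.add_one_mul_choose_eq (2 * k) k
      rw [← Nat.centralBinom_eq_two_mul_choose] at this
      have : ((2 * k + 1 : ℕ) : ℝ) * k.centralBinom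
        = ((2 * k + 1).choose (k + 1) : ℝ) * (k + 1 : ℕ) := by exact_mod_cast this
      push_cast at this
      linarith
    rw [if_pos (by lia), if_neg (by lia), show (2 * k + 1 + 1) / 2 = k + 1 by lia]
    have h4 : ((2 : ℝ) ^ (2 * k + 1)) ^ 2 = 4 * 16 ^ k := by
      rw [← pow_mul, mul_comm, pow_mul, pow_succ, pow_mul]; norm_num; ring
    have h1 : (((-1 : ℝ)) ^ (2 * k + 1 - (k + 1))) ^ 2 = 1 := by
      rw [← pow_mul, mul_comm, pow_mul]; norm_num
    rw [div_pow _ _ 2, h4, mul_pow, mul_pow, h1]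
    push_cast
    have : (0 : ℝ) < 16 ^ k := by positivity
    rw [show (2 * (k : ℝ) + 1 + 1) ^ 2 * (1 * ((2 * k + 1).choose (k + 1) : ℝ) ^ 2)
      = 4 * (((k : ℝ) + 1) * ((2 * k + 1).choose (k + 1) : ℝ)) ^ 2 by ring, hc]
    norm_num
    rw [div_le_iff₀ (by positivity)]
    nlinarith [mul_le_mul_of_nonneg_left h (by positivity : (0 : ℝ) ≤ 2 * k + 1)]

theorem X_sq_sub_one_pow_iterate_derivative_ode (n k : ℕ) :
    (X ^ 2 - 1) * derivative^[k + 2] ((X ^ 2 - 1 : ℝ[X]) ^ n)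
      + C (2 * ((k : ℝ) + 1 - n)) * X * derivative^[k + 1] ((X ^ 2 - 1) ^ n)
      + C (((k : ℝ) + 1) * (k - 2 * n)) * derivative^[k] ((X ^ 2 - 1) ^ n) = 0 := by
  induction k with
  | zero =>
    have h : (X ^ 2 - 1) * derivative ((X ^ 2 - 1 : ℝ[X]) ^ n) =
        C (2 * (n : ℝ)) * X * (X ^ 2 - 1) ^ n := by
      cases n with
      | zero => simp
      | succ n =>
        rw [derivative_pow]
        simp [map_ofNat C 2]
        ring
    have h' := congrArg derivative h
    simp only [derivative_mul, derivative_sub, derivative_X_pow, derivative_one, derivative_C,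
      derivative_X] at h'
    simp only [Function.iterate_succ_apply', Function.iterate_zero, id]
    simp [map_ofNat C 2] at h' ⊢
    linear_combination h'
  | succ k ih =>
    have h' := congrArg derivative ih
    simp only [derivative_mul, derivative_add, derivative_sub, derivative_X_pow, derivative_one,
      derivative_C, derivative_X, derivative_zero, ← Function.iterate_succ_apply'] at h'
    simp [map_ofNat C 2] at h' ⊢
    linear_combination h'

theorem derivative_one_sub_X_sq_mul_derivative_legendreP (n : ℕ) :
    derivative ((1 - X ^ 2) * derivative (legendreP n)) =
      -C ((n : ℝ) * (n + 1)) * legendreP n := by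
  have h := X_sq_sub_one_pow_iterate_derivative_ode n n
  simp only [legendreP, derivative_mul, derivative_C, derivative_sub, derivative_X_pow,
    derivative_one, zero_mul, zero_add, Function.iterate_succ_apply'] at h ⊢
  simp [map_ofNat C 2] at h ⊢
  linear_combination -(C ((n.factorial : ℝ)⁻¹) * C ((2 ^ n)⁻¹)) * h

theorem sturm_energy_le {P : ℝ[X]} {c : ℝ} (hc : 0 ≤ c)
    (hP : derivative ((1 - X ^ 2) * derivative P) = -C c * P) (x : ℝ) :
    ((1 - x ^ 2) * (derivative P).eval x) ^ 2 + c * (1 - x ^ 2) * P.eval x ^ 2 ≤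
      (derivative P).eval 0 ^ 2 + c * P.eval 0 ^ 2 := by
  set G : ℝ[X] := ((1 - X ^ 2) * derivative P) ^ 2 + C c * (1 - X ^ 2) * P ^ 2 with hG
  have hG' : derivative G = -C (2 * c) * X * P ^ 2 := by
    rw [hG, derivative_add, derivative_pow, hP]
    simp [derivative_pow]
    ring
  have hder (y : ℝ) : HasDerivAt (fun y => G.eval y) (-(2 * c) * y * P.eval y ^ 2) y := by
    simpa [hG'] using G.hasDerivAt y
  have hcont : Continuous fun y => G.eval y := G.continuous
  suffices G.eval x ≤ G.eval 0 by simpa [hG] using this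
  rcases le_total 0 x with hx | hx
  · refine antitoneOn_of_deriv_nonpos (convex_Ici 0) hcont.continuousOn
      (fun y _ => (hder y).differentiableAt.differentiableWithinAt) (fun y hy => ?_)
      (mem_Ici.2 le_rfl) (mem_Ici.2 hx) hx
    rw [interior_Ici, mem_Ioi] at hy
    rw [(hder y).deriv]
    have : 0 ≤ 2 * c * y * P.eval y ^ 2 := by positivity
    linarith
  · refine monotoneOn_of_deriv_nonneg (convex_Iic 0) hcont.continuousOn
      (fun y _ => (hder y).differentiableAt.differentiableWithinAt) (fun y hy => ?_)
      (mem_Iic.2 hx) (mem_Iic.2 le_rfl) hx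
    rw [interior_Iic, mem_Iio] at hy
    rw [(hder y).deriv]
    have : 0 ≤ 2 * c * (-y) * P.eval y ^ 2 := by
      have : 0 ≤ -y := by linarith
      positivity
    linarith

theorem legendreP_energy_le {n : ℕ} (hn : 1 ≤ n) (x : ℝ) :
    ((1 - x ^ 2) * (derivative (legendreP n)).eval x) ^ 2
      + n * (n + 1) * (1 - x ^ 2) * (legendreP n).eval x ^ 2 ≤ n :=
  (sturm_energy_le (by positivity) (derivative_one_sub_X_sq_mul_derivative_legendreP n) x).trans
    (legendreP_energy_zero_le n hn)

theorem BoundedVariationOn.intervalIntegrable {h : ℝ → ℝ} {a b : ℝ} (hab : a ≤ b)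
    (hBV : BoundedVariationOn h (Icc a b)) : IntervalIntegrable h volume a b := by
  have ha : a ∈ Icc a b := left_mem_Icc.2 hab
  have h1 := variationOnFromTo.monotoneOn hBV.locallyBoundedVariationOn ha
  have h2 := variationOnFromTo.sub_self_monotoneOn hBV.locallyBoundedVariationOn ha
  rw [← uIcc_of_le hab] at h1 h2
  simpa using h1.intervalIntegrable.sub h2.intervalIntegrable

theorem sum_mul_sub_eq (f g : ℕ → ℝ) (N : ℕ) :
    ∑ i ∈ Finset.range N, f i * (g (i + 1) - g i) =
      f N * g N - f 0 * g 0 - ∑ i ∈ Finset.range N, g (i + 1) * (f (i + 1) - f i) := by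
  induction N with
  | zero => simp
  | succ N ih => rw [Finset.sum_range_succ, Finset.sum_range_succ, ih]; ring

theorem abs_integral_mul_sub_le {h T w v : ℝ → ℝ} {a b W : ℝ} (hab : a ≤ b)
    (hh : IntervalIntegrable h volume a b) (hw : Continuous w)
    (hT : ∀ x, HasDerivAt T (w x) x)
    (hv : ∀ x ∈ Icc a b, |h x - h a| ≤ v b - v a) (hW : ∀ x ∈ Icc a b, |w x| ≤ W) :
    |(∫ x in a..b, h x * w x) - h a * (T b - T a)| ≤ (v b - v a) * W * (b - a) := by
  have hTint : ∫ x in a..b, w x = T b - T a :=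
    intervalIntegral.integral_eq_sub_of_hasDerivAt (fun x _ => hT x) (hw.intervalIntegrable _ _)
  rw [← hTint, ← intervalIntegral.integral_const_mul, ← intervalIntegral.integral_sub
    (hh.mul_continuousOn hw.continuousOn) ((hw.intervalIntegrable _ _).const_mul _)]
  have := intervalIntegral.norm_integral_le_of_norm_le_const (a := a) (b := b)
    (f := fun x => h x * w x - h a * w x) (C := (v b - v a) * W) fun x hx => by
      rw [uIoc_of_le hab] at hx
      have hx' := Ioc_subset_Icc_self hx
      rw [Real.norm_eq_abs, ← sub_mul, abs_mul]
      exact mul_le_mul (hv x hx') (hW x hx') (abs_nonneg _) ((abs_nonneg _).trans (hv x hx'))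
  rwa [Real.norm_eq_abs, abs_of_nonneg (sub_nonneg.2 hab)] at this

theorem BoundedVariationOn.abs_integral_mul_deriv_le {h T w : ℝ → ℝ} {a b M : ℝ} (hab : a ≤ b)
    (hBV : BoundedVariationOn h (Icc a b)) (hw : Continuous w)
    (hT : ∀ x, HasDerivAt T (w x) x) (hTa : T a = 0) (hTb : T b = 0)
    (hM : ∀ x ∈ Icc a b, |T x| ≤ M) :
    |∫ x in a..b, h x * w x| ≤ M * (eVariationOn h (Icc a b)).toReal := by
  have ha : a ∈ Icc a b := left_mem_Icc.2 hab
  have hb : b ∈ Icc a b := right_mem_Icc.2 hab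
  have hM0 : 0 ≤ M := (abs_nonneg _).trans (hM a ha)
  set V := (eVariationOn h (Icc a b)).toReal with hV
  set v := variationOnFromTo h (Icc a b) a with hv
  have hva : v a = 0 := variationOnFromTo.self ..
  have hvb : v b = V := by rw [hv, variationOnFromTo.eq_of_le _ _ hab, inter_self]
  obtain ⟨W, hW⟩ := isCompact_Icc.exists_bound_of_continuousOn (s := Icc a b) hw.continuousOn
  have hint := hBV.intervalIntegrable hab
  have key (N : ℕ) (hN : 0 < N) :
      |∫ x in a..b, h x * w x| ≤ M * V + V * W * (b - a) / N := by
    have hN' : (0 : ℝ) < N := by exact_mod_cast hN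
    set x : ℕ → ℝ := fun i => a + i * ((b - a) / N) with hx
    have hx0 : x 0 = a := by simp [hx]
    have hxN : x N = b := by simp only [hx]; field_simp; ring
    have hstep (i : ℕ) : x (i + 1) - x i = (b - a) / N := by simp only [hx]; push_cast; ring
    have hxmono : Monotone x := monotone_nat_of_le_succ fun i => by
      have : 0 ≤ (b - a) / N := div_nonneg (sub_nonneg.2 hab) hN'.le
      linarith [hstep i]
    have hmem (i : ℕ) (hi : i ≤ N) : x i ∈ Icc a b :=
      ⟨hx0 ▸ hxmono (Nat.zero_le i), hxN ▸ hxmono hi⟩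
    have hsub (i : ℕ) (hi : i < N) : Icc (x i) (x (i + 1)) ⊆ Icc a b :=
      Icc_subset_Icc (hmem i hi.le).1 (hmem (i + 1) hi).2
    have hvar {y z : ℝ} (hy : y ∈ Icc a b) (hz : z ∈ Icc a b) (hyz : y ≤ z) :
        |h z - h y| ≤ v z - v y :=
      variationOnFromTo.abs_sub_le_sub_of_le hBV.locallyBoundedVariationOn ha hy hz hyz
    have hvsum : ∑ i ∈ Finset.range N, (v (x (i + 1)) - v (x i)) = V := by
      rw [Finset.sum_range_sub (fun i => v (x i)), hxN, hx0, hva, hvb, sub_zero]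
    have hinti (i : ℕ) (hi : i < N) : IntervalIntegrable h volume (x i) (x (i + 1)) :=
      hint.mono_set (by
        rw [uIcc_of_le hab, uIcc_of_le (hxmono (Nat.le_succ i))]; exact hsub i hi)
    have hI : ∑ i ∈ Finset.range N, ∫ t in (x i)..(x (i + 1)), h t * w t
        = ∫ t in a..b, h t * w t := by
      rw [intervalIntegral.sum_integral_adjacent_intervals
        (fun i hi => (hinti i hi).mul_continuousOn hw.continuousOn), hx0, hxN]
    have herr : |∑ i ∈ Finset.range N, ((∫ t in (x i)..(x (i + 1)), h t * w t)
        - h (x i) * (T (x (i + 1)) - T (x i)))| ≤ V * W * (b - a) / N := by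
      calc _ ≤ ∑ i ∈ Finset.range N, (v (x (i + 1)) - v (x i)) * W * ((b - a) / N) := by
            refine (Finset.abs_sum_le_sum_abs _ _).trans (Finset.sum_le_sum fun i hi => ?_)
            have hi := Finset.mem_range.1 hi
            rw [← hstep i]
            refine abs_integral_mul_sub_le (hxmono (Nat.le_succ i)) (hinti i hi) hw hT
              (fun t ht => ?_) fun t ht => hW t (hsub i hi ht)
            have ht' := hsub i hi ht
            refine (hvar (hmem i hi.le) ht' ht.1).trans (sub_le_sub_right ?_ _)
            exact variationOnFromTo.monotoneOn hBV.locallyBoundedVariationOn ha ht'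
              (hmem (i + 1) hi) ht.2
        _ = V * W * (b - a) / N := by rw [← Finset.sum_mul, ← Finset.sum_mul, hvsum]; ring
    have hmain : |∑ i ∈ Finset.range N, h (x i) * (T (x (i + 1)) - T (x i))| ≤ M * V := by
      rw [sum_mul_sub_eq (fun i => h (x i)) (fun i => T (x i)), hx0, hxN, hTa, hTb, mul_zero,
        mul_zero, sub_zero, zero_sub, abs_neg, ← hvsum, Finset.mul_sum]
      refine (Finset.abs_sum_le_sum_abs _ _).trans (Finset.sum_le_sum fun i hi => ?_)
      have hi := Finset.mem_range.1 hi
      rw [abs_mul]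
      exact mul_le_mul (hM _ (hmem _ hi))
        (hvar (hmem i hi.le) (hmem (i + 1) hi) (hxmono (Nat.le_succ i))) (abs_nonneg _) hM0
    rw [Finset.sum_sub_distrib, hI] at herr
    have := abs_sub_abs_le_abs_sub (∫ t in a..b, h t * w t)
      (∑ i ∈ Finset.range N, h (x i) * (T (x (i + 1)) - T (x i)))
    linarith
  have hlim : Filter.Tendsto (fun N : ℕ => M * V + V * W * (b - a) / N) Filter.atTop
      (nhds (M * V)) := by
    simpa using (tendsto_const_div_atTop_nhds_zero_nat (V * W * (b - a))).const_add (M * V)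
  exact ge_of_tendsto hlim (Filter.eventually_atTop.2 ⟨1, fun N hN => key N hN⟩)

theorem IntervalIntegrable.integral_primitive_mul_eq {h H q y : ℝ → ℝ} {a b : ℝ} (hab : a ≤ b)
    (hint : IntervalIntegrable h volume a b)
    (hH : ∀ t ∈ Icc a b, H t = H a + ∫ s in a..t, h s)
    (hq : ContDiff ℝ 1 q) (hqy : ∀ x, HasDerivAt q (y x) x) (hqa : q a = 0) (hqb : q b = 0) :
    ∫ t in a..b, H t * y t = -∫ t in a..b, h t * q t := by
  set F : ℝ → ℝ := fun t => H a + ∫ s in a..t, h s with hF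
  have hFac : AbsolutelyContinuousOnInterval F a b := by
    have h1 := hint.absolutelyContinuousOnInterval_intervalIntegral (c := a) left_mem_uIcc
    have h2 : AbsolutelyContinuousOnInterval (fun _ : ℝ => H a) a b :=
      contDiffOn_const.absolutelyContinuousOnInterval
    exact h2.add h1
  have hparts := hFac.integral_mul_deriv_eq_deriv_mul
    (hq.contDiffOn.absolutelyContinuousOnInterval (a := a) (b := b))
  rw [hqa, hqb, mul_zero, mul_zero, sub_zero, zero_sub] at hparts
  calc ∫ t in a..b, H t * y t = ∫ t in a..b, F t * deriv q t :=
        intervalIntegral.integral_congr fun t ht => by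
          rw [uIcc_of_le hab] at ht
          simp only [hF, ← hH t ht, (hqy t).deriv]
    _ = -∫ t in a..b, deriv F t * q t := hparts
    _ = -∫ t in a..b, h t * q t := by
        congr 1
        refine intervalIntegral.integral_congr_ae ?_
        filter_upwards [hint.ae_hasDerivAt_integral] with t ht htm
        rw [((ht (uIoc_subset_uIcc htm) a left_mem_uIcc).const_add (H a)).deriv]

theorem legendreCoeff_eq {h H : ℝ → ℝ} (hint : IntervalIntegrable h volume (-1) 1)
    (hH : ∀ t ∈ Icc (-1 : ℝ) 1, H t = H (-1) + ∫ s in (-1 : ℝ)..t, h s) {n : ℕ} (hn : 1 ≤ n) :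
    legendreCoeff H n = (n + 1 / 2) / (n * (n + 1)) *
      ∫ t in (-1 : ℝ)..1, h t * ((1 - t ^ 2) * (derivative (legendreP n)).eval t) := by
  have hn' : (0 : ℝ) < n * (n + 1) := by positivity
  set Q : ℝ[X] := -C ((n * (n + 1) : ℝ)⁻¹) * ((1 - X ^ 2) * derivative (legendreP n)) with hQ
  have hQ' : derivative Q = legendreP n := by
    rw [hQ, derivative_mul, derivative_one_sub_X_sq_mul_derivative_legendreP, derivative_neg,
      derivative_C, neg_zero, zero_mul, zero_add, ← mul_assoc, neg_mul_neg, ← C_mul,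
      inv_mul_cancel₀ hn'.ne', C_1, one_mul]
  have hQeval (t : ℝ) :
      Q.eval t = -((n * (n + 1) : ℝ)⁻¹ * ((1 - t ^ 2) * (derivative (legendreP n)).eval t)) := by
    simp only [hQ, eval_mul, eval_neg, eval_C, eval_sub, eval_one, eval_pow, eval_X, neg_mul]
  have key := hint.integral_primitive_mul_eq (q := fun t => Q.eval t)
    (y := fun t => (legendreP n).eval t) (by norm_num) hH (by simpa using Q.contDiff_aeval (𝕜 := ℝ) 1)
    (fun t => hQ' ▸ Q.hasDerivAt t) (by simp [hQeval]) (by simp [hQeval])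
  rw [legendreCoeff, key]
  simp only [hQeval, mul_neg, intervalIntegral.integral_neg, neg_neg, mul_left_comm _ (_⁻¹),
    intervalIntegral.integral_const_mul]
  ring

theorem hasDerivAt_primitive_one_sub_sq_mul_derivative_legendreP {n : ℕ} (hn : 2 ≤ n) (x : ℝ) :
    HasDerivAt (fun x => (-2 * x * ((1 - x ^ 2) * (derivative (legendreP n)).eval x) +
      n * (n + 1) * (1 - x ^ 2) * (legendreP n).eval x) / ((n : ℝ) * (n + 1) - 2))
      ((1 - x ^ 2) * (derivative (legendreP n)).eval x) x := by
  have hn' : (2 : ℝ) ≤ n := by exact_mod_cast hn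
  have h0 : (n : ℝ) * (n + 1) - 2 ≠ 0 := by nlinarith
  have hw : HasDerivAt (fun x => (1 - x ^ 2) * (derivative (legendreP n)).eval x)
      (-(n * (n + 1)) * (legendreP n).eval x) x := by
    have := ((1 - X ^ 2) * derivative (legendreP n)).hasDerivAt x
    rw [derivative_one_sub_X_sq_mul_derivative_legendreP] at this
    simpa using this
  have hp : HasDerivAt (fun x : ℝ => (n * (n + 1) : ℝ) * (1 - x ^ 2))
      (n * (n + 1) * (-(2 * x))) x := by
    simpa using ((hasDerivAt_pow 2 x).const_sub 1).const_mul (n * (n + 1) : ℝ)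
  have hx : HasDerivAt (fun x : ℝ => -2 * x) (-2) x := by
    simpa using (hasDerivAt_id x).const_mul (-2)
  refine (((hx.mul hw).add (hp.mul ((legendreP n).hasDerivAt x))).div_const
    ((n : ℝ) * (n + 1) - 2)).congr_deriv ?_
  rw [div_eq_iff h0]
  ring

theorem abs_primitive_one_sub_sq_mul_derivative_legendreP_le {n : ℕ} (hn : 2 ≤ n) {x : ℝ}
    (hx : x ∈ Icc (-1 : ℝ) 1) :
    |(-2 * x * ((1 - x ^ 2) * (derivative (legendreP n)).eval x) +
      n * (n + 1) * (1 - x ^ 2) * (legendreP n).eval x) / ((n : ℝ) * (n + 1) - 2)| ≤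
      √n * (n + 5 / 2) / (n * (n + 1) - 2) := by
  have hn' : (2 : ℝ) ≤ n := by exact_mod_cast hn
  have h0 : 0 < (n : ℝ) * (n + 1) - 2 := by nlinarith
  have hE := legendreP_energy_le (by lia : 1 ≤ n) x
  have hx1 : |x| ≤ 1 := abs_le.2 hx
  have hx2 : 0 ≤ 1 - x ^ 2 := by nlinarith [hx.1, hx.2]
  set w := (1 - x ^ 2) * (derivative (legendreP n)).eval x
  set y := (legendreP n).eval x
  have hs : √(n : ℝ) ^ 2 = n := Real.sq_sqrt (by positivity)
  have hy0 : 0 ≤ n * (n + 1) * (1 - x ^ 2) * y ^ 2 := by positivity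
  have hw : |w| ≤ √n := Real.abs_le_sqrt (by linarith)
  have hy : |n * (n + 1) * (1 - x ^ 2) * y| ≤ (n + 1 / 2) * √n := by
    refine abs_le_of_sq_le_sq ?_ (by positivity)
    rw [mul_pow (_ + _) _ 2, hs]
    calc ((n : ℝ) * (n + 1) * (1 - x ^ 2) * y) ^ 2
        = (n * (n + 1)) * (1 - x ^ 2) * (n * (n + 1) * (1 - x ^ 2) * y ^ 2) := by ring
      _ ≤ ((n : ℝ) + 1 / 2) ^ 2 * 1 * n := by
        gcongr
        · nlinarith
        · nlinarith
        · nlinarith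
      _ = _ := by ring
  rw [abs_div, abs_of_pos h0]
  gcongr
  calc _ ≤ |-2 * x * w| + |n * (n + 1) * (1 - x ^ 2) * y| := abs_add_le _ _
    _ = 2 * |x| * |w| + |n * (n + 1) * (1 - x ^ 2) * y| := by simp [abs_mul]
    _ ≤ 2 * 1 * √n + (n + 1 / 2) * √n := by gcongr
    _ = _ := by ring

theorem abs_legendreCoeff_one_le {h H : ℝ → ℝ} {U : ℝ} (hint : IntervalIntegrable h volume (-1) 1)
    (hU : ∀ t ∈ Icc (-1 : ℝ) 1, |h t| ≤ U)
    (hH : ∀ t ∈ Icc (-1 : ℝ) 1, H t = H (-1) + ∫ s in (-1 : ℝ)..t, h s) :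
    |legendreCoeff H 1| ≤ 3 / 2 * U := by
  have hbound := intervalIntegral.norm_integral_le_of_norm_le_const (a := -1) (b := 1) (C := U)
    (f := fun t => h t * ((1 - t ^ 2) * (derivative (legendreP 1)).eval t)) fun t ht => by
      rw [uIoc_of_le (by norm_num)] at ht
      have ht' := Ioc_subset_Icc_self ht
      have hE := legendreP_energy_le le_rfl t
      have ht2 : 0 ≤ 1 - t ^ 2 := by nlinarith [ht'.1, ht'.2]
      have hw : |(1 - t ^ 2) * (derivative (legendreP 1)).eval t| ≤ 1 := by
        refine (sq_le_one_iff_abs_le_one _).1 ?_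
        push_cast at hE
        nlinarith [mul_nonneg ht2 (sq_nonneg ((legendreP 1).eval t))]
      rw [Real.norm_eq_abs, abs_mul]
      exact (mul_le_of_le_one_right (abs_nonneg _) hw).trans (hU t ht')
  rw [legendreCoeff_eq hint hH le_rfl, abs_mul]
  norm_num at hbound ⊢
  linarith

theorem abs_legendreCoeff_le {h H : ℝ → ℝ} (hBV : BoundedVariationOn h (Icc (-1 : ℝ) 1))
    (hH : ∀ t ∈ Icc (-1 : ℝ) 1, H t = H (-1) + ∫ s in (-1 : ℝ)..t, h s) {n : ℕ} (hn : 2 ≤ n) :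
    |legendreCoeff H n| ≤ 3 * (eVariationOn h (Icc (-1 : ℝ) 1)).toReal / (n * √n) := by
  have hn' : (2 : ℝ) ≤ n := by exact_mod_cast hn
  have h0 : 0 < (n : ℝ) * (n + 1) - 2 := by nlinarith
  have hs : √(n : ℝ) * √n = n := Real.mul_self_sqrt (by positivity)
  have hbound := hBV.abs_integral_mul_deriv_le (by norm_num) (by fun_prop)
    (hasDerivAt_primitive_one_sub_sq_mul_derivative_legendreP hn) (by simp) (by simp)
    fun x hx => abs_primitive_one_sub_sq_mul_derivative_legendreP_le hn hx
  rw [legendreCoeff_eq (hBV.intervalIntegrable (by norm_num)) hH (by lia), abs_mul,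
    abs_of_nonneg (by positivity)]
  set V := (eVariationOn h (Icc (-1 : ℝ) 1)).toReal
  have hV : 0 ≤ V := ENNReal.toReal_nonneg
  have hc : ((n : ℝ) + 1 / 2) / (n * (n + 1)) * (√n * (n + 5 / 2) / (n * (n + 1) - 2)) ≤
      3 / (n * √n) := by
    rw [div_mul_div_comm, div_le_div_iff₀ (by positivity) (by positivity)]
    calc ((n : ℝ) + 1 / 2) * (√n * (n + 5 / 2)) * (n * √n)
        = (n + 1 / 2) * (n + 5 / 2) * n * (√n * √n) := by ring
      _ = n * (n * ((n + 1 / 2) * (n + 5 / 2))) := by rw [hs]; ring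
      _ ≤ n * (3 * (n + 1) * (n * (n + 1) - 2)) := by
        refine mul_le_mul_of_nonneg_left ?_ (by positivity)
        nlinarith [mul_nonneg (sub_nonneg.2 hn') (sub_nonneg.2 hn'),
          mul_nonneg (mul_nonneg (sub_nonneg.2 hn') (sub_nonneg.2 hn')) (sub_nonneg.2 hn')]
      _ = _ := by ring
  calc _ ≤ ((n : ℝ) + 1 / 2) / (n * (n + 1)) * (√n * (n + 5 / 2) / (n * (n + 1) - 2) * V) := by
        gcongr
    _ = ((n : ℝ) + 1 / 2) / (n * (n + 1)) * (√n * (n + 5 / 2) / (n * (n + 1) - 2)) * V := by ring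
    _ ≤ 3 / (n * √n) * V := by gcongr
    _ = _ := by ring

end

/-- Jackson's theorem: if `h` has bounded variation `V` and bound `U` on `[-1,1]`,
and `H(t) = H(-1) + ∫_{-1}^t h`, then the Legendre coefficients of `H` satisfy
`|a_n| ≤ (6/√π)(U+V) n^{-3/2}` for all `n ≥ 1`. -/
theorem stmt2_jackson
    (h H : ℝ → ℝ) (U V : ℝ)
    (hU : ∀ t ∈ Icc (-1 : ℝ) 1, |h t| ≤ U)
    (hBV : BoundedVariationOn h (Icc (-1 : ℝ) 1))
    (hV : (eVariationOn h (Icc (-1 : ℝ) 1)).toReal = V)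
    (hH : ∀ t ∈ Icc (-1 : ℝ) 1, H t = H (-1) + ∫ s in (-1 : ℝ)..t, h s) :
    ∀ n : ℕ, 1 ≤ n →
      |legendreCoeff H n| ≤ 6 / Real.sqrt Real.pi * (U + V) / (n : ℝ) ^ ((3 : ℝ) / 2) := by
  intro n hn
  have hU0 : 0 ≤ U := (abs_nonneg _).trans (hU 0 (by norm_num))
  have hV0 : 0 ≤ V := hV ▸ ENNReal.toReal_nonneg
  have hpi : 3 ≤ 6 / Real.sqrt Real.pi := by
    have : Real.sqrt Real.pi ≤ 2 := Real.sqrt_le_iff.2 ⟨by norm_num, by linarith [Real.pi_le_four]⟩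
    rw [le_div_iff₀ (by positivity)]
    linarith
  have hpow : (n : ℝ) ^ ((3 : ℝ) / 2) = n * √n := by
    rw [show (3 : ℝ) / 2 = 1 + 1 / 2 by norm_num, Real.rpow_add (by positivity), Real.rpow_one,
      Real.sqrt_eq_rpow]
  have hle : 3 * (U + V) / (n * √n) ≤ 6 / Real.sqrt Real.pi * (U + V) / (n * √n) := by gcongr
  rw [hpow]
  refine le_trans ?_ hle
  obtain rfl | hn2 : n = 1 ∨ 2 ≤ n := by lia
  · have := abs_legendreCoeff_one_le (hBV.intervalIntegrable (by norm_num)) hU hH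
    norm_num
    linarith
  · refine (abs_legendreCoeff_le hBV hH hn2).trans ?_
    rw [hV]
    gcongr
    linarith
end

section
/- Let (x(t),u(t)) solve the chained system ẋ_i = x_{i+1} (i<r), ẋ_r = f(x) + g(x)u on [-1,1], where x_r^{(m)} has bounded variation, m ≥ 2, and f, g are Lipschitz with g nowhere zero. For each 1 ≤ m₁ ≤ m-1 there exist M, N₁ > 0 such that for every N ≥ N₁ there is a solution (x^N, u^N) of the same system with x^N polynomial of degree ≤ N, x^N(-1) = x(-1), and ‖x_i^N - x_i‖_∞ ≤ M‖x_r‖_{W^{m,2}} (N-r-m₁+1)^{-(m-m₁)+3/4} for all i, and similarly for ‖(x_r^N)^{(l)} - x_r^{(l)}‖_∞, l ≤ m₁, and ‖u^N - u‖_∞. -/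
open Set Polynomial

theorem integral_cos_int_mul (d : ℤ) :
    ∫ t in (-Real.pi)..Real.pi, Real.cos (d * t) = if d = 0 then 2 * Real.pi else 0 := by
  split_ifs with h
  · simp [h]; ring
  · have hd : (d : ℝ) ≠ 0 := by exact_mod_cast h
    rw [intervalIntegral.integral_comp_mul_left (fun t => Real.cos t) hd]
    simp [Real.sin_int_mul_pi]

/-- The squared modulus of the trigonometric polynomial `∑ j < n, b j * exp (i j t)`. -/
noncomputable def trigSq (b : ℕ → ℝ) (n : ℕ) (t : ℝ) : ℝ :=
  (∑ j ∈ Finset.range n, b j * Real.cos (j * t)) ^ 2 +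
    (∑ j ∈ Finset.range n, b j * Real.sin (j * t)) ^ 2

theorem trigSq_nonneg (b : ℕ → ℝ) (n : ℕ) (t : ℝ) : 0 ≤ trigSq b n t := by
  unfold trigSq; positivity

@[fun_prop]
theorem continuous_trigSq (b : ℕ → ℝ) (n : ℕ) : Continuous (trigSq b n) := by
  unfold trigSq; fun_prop

theorem trigSq_eq_sum (b : ℕ → ℝ) (n : ℕ) (t : ℝ) :
    trigSq b n t = ∑ j ∈ Finset.range n, ∑ l ∈ Finset.range n,
      b j * b l * Real.cos (((j : ℤ) - (l : ℤ) : ℤ) * t) := by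
  unfold trigSq
  rw [sq, sq, Finset.sum_mul_sum, Finset.sum_mul_sum, ← Finset.sum_add_distrib]
  refine Finset.sum_congr rfl fun j _ => ?_
  rw [← Finset.sum_add_distrib]
  refine Finset.sum_congr rfl fun l _ => ?_
  push_cast
  rw [sub_mul, Real.cos_sub]
  ring

theorem integral_trigSq (b : ℕ → ℝ) (n : ℕ) :
    ∫ t in (-Real.pi)..Real.pi, trigSq b n t =
      2 * Real.pi * ∑ j ∈ Finset.range n, b j ^ 2 := by
  simp_rw [trigSq_eq_sum]
  rw [intervalIntegral.integral_finsetSum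
    (fun j _ => (by fun_prop : Continuous _).intervalIntegrable _ _), Finset.mul_sum]
  refine Finset.sum_congr rfl fun j hj => ?_
  rw [intervalIntegral.integral_finsetSum
    (fun j _ => (by fun_prop : Continuous _).intervalIntegrable _ _)]
  simp_rw [intervalIntegral.integral_const_mul, integral_cos_int_mul]
  rw [Finset.sum_eq_single j]
  · simp; ring
  · intro l _ hl
    rw [if_neg (by omega), mul_zero]
  · intro h; exact absurd hj h

theorem trigSq_sub (a : ℕ → ℝ) (n : ℕ) (h0 : a 0 = 0) (hn : a n = 0) (t : ℝ) :
    trigSq (fun j => a (j + 1) - a j) n t = 2 * (1 - Real.cos t) * trigSq a n t := by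
  have shift : ∀ F : ℕ → ℝ, ∑ j ∈ Finset.range n, a (j + 1) * F (j + 1) =
      ∑ j ∈ Finset.range n, a j * F j := by
    intro F
    have h := Finset.sum_range_succ' (fun j => a j * F j) n
    rw [Finset.sum_range_succ, h0, hn] at h
    linarith
  have hc : ∑ j ∈ Finset.range n, (a (j + 1) - a j) * Real.cos (j * t) =
      (∑ j ∈ Finset.range n, a j * Real.cos (j * t)) * Real.cos t +
      (∑ j ∈ Finset.range n, a j * Real.sin (j * t)) * Real.sin t -
      ∑ j ∈ Finset.range n, a j * Real.cos (j * t) := by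
    rw [← shift (fun j => Real.cos (j * t)), ← shift (fun j => Real.sin (j * t)),
      Finset.sum_mul, Finset.sum_mul, shift (fun j => Real.cos (j * t)),
      ← Finset.sum_add_distrib, ← Finset.sum_sub_distrib]
    refine Finset.sum_congr rfl fun j _ => ?_
    have : Real.cos (j * t) = Real.cos ((j + 1 : ℕ) * t - t) := by congr 1; push_cast; ring
    rw [sub_mul]
    nth_rw 1 [this]
    rw [Real.cos_sub]; ring
  have hs : ∑ j ∈ Finset.range n, (a (j + 1) - a j) * Real.sin (j * t) =
      (∑ j ∈ Finset.range n, a j * Real.sin (j * t)) * Real.cos t -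
      (∑ j ∈ Finset.range n, a j * Real.cos (j * t)) * Real.sin t -
      ∑ j ∈ Finset.range n, a j * Real.sin (j * t) := by
    rw [← shift (fun j => Real.cos (j * t)), ← shift (fun j => Real.sin (j * t)),
      Finset.sum_mul, Finset.sum_mul, shift (fun j => Real.sin (j * t)),
      ← Finset.sum_sub_distrib, ← Finset.sum_sub_distrib]
    refine Finset.sum_congr rfl fun j _ => ?_
    have : Real.sin (j * t) = Real.sin ((j + 1 : ℕ) * t - t) := by congr 1; push_cast; ring
    rw [sub_mul]
    nth_rw 1 [this]
    rw [Real.sin_sub]; ring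
  unfold trigSq
  rw [hc, hs]
  linear_combination ((∑ j ∈ Finset.range n, a j * Real.cos (j * t)) ^ 2 +
    (∑ j ∈ Finset.range n, a j * Real.sin (j * t)) ^ 2) * Real.sin_sq_add_cos_sq t

theorem sum_parabola_sq (n : ℕ) :
    ∑ j ∈ Finset.range n, ((j : ℝ) * (n - j)) ^ 2 = ((n : ℝ) ^ 5 - n) / 30 := by
  have key : ∀ (c : ℝ) (k : ℕ), ∑ j ∈ Finset.range k, ((j : ℝ) * (c - j)) ^ 2 =
      c ^ 2 * ((k - 1) * k * (2 * k - 1) / 6) - 2 * c * ((k - 1) * k / 2) ^ 2 +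
      (k - 1) * k * (2 * k - 1) * (3 * (k - 1) ^ 2 + 3 * (k - 1) - 1) / 30 := by
    intro c k
    induction k with
    | zero => simp
    | succ k ih => rw [Finset.sum_range_succ, ih]; push_cast; ring
  rw [key]; ring

theorem sum_parabola_diff_sq (n : ℕ) :
    ∑ j ∈ Finset.range n,
      (((j + 1 : ℕ) : ℝ) * (n - (j + 1 : ℕ)) - (j : ℝ) * (n - j)) ^ 2 ≤ (n : ℝ) ^ 3 := by
  have : ∀ j ∈ Finset.range n,
      (((j + 1 : ℕ) : ℝ) * (n - (j + 1 : ℕ)) - (j : ℝ) * (n - j)) ^ 2 ≤ (n : ℝ) ^ 2 := by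
    intro j hj
    have h : (j : ℝ) + 1 ≤ n := by exact_mod_cast Finset.mem_range.1 hj
    have h0 : (0 : ℝ) ≤ j := by positivity
    push_cast
    nlinarith
  refine (Finset.sum_le_sum this).trans (le_of_eq ?_)
  simp; ring

/-- A nonnegative trigonometric kernel concentrated at scale `1 / n`. -/
theorem exists_kernel (n : ℕ) (hn : 2 ≤ n) : ∃ a : ℕ → ℝ,
    ∫ t in (-Real.pi)..Real.pi, trigSq a n t = 1 ∧
    ∫ t in (-Real.pi)..Real.pi, |t| * trigSq a n t ≤ 50 / n := by
  set p : ℕ → ℝ := fun j => (j : ℝ) * (n - j) with hp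
  have hn' : (2 : ℝ) ≤ n := by exact_mod_cast hn
  have hpi := Real.pi_pos
  set W := 2 * Real.pi * (((n : ℝ) ^ 5 - n) / 30) with hW
  have h4 : 15 / 16 * (n : ℝ) ^ 5 ≤ (n : ℝ) ^ 5 - n := by
    have : (2 : ℝ) ^ 4 ≤ (n : ℝ) ^ 4 := by gcongr
    nlinarith
  have hn5 : (0 : ℝ) < (n : ℝ) ^ 5 := by positivity
  have hW0 : 0 < W := by rw [hW]; apply mul_pos <;> [positivity; linarith]
  have I1 : ∫ t in (-Real.pi)..Real.pi, trigSq p n t = W := by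
    rw [integral_trigSq, hW, ← sum_parabola_sq]
  have I2 : ∫ t in (-Real.pi)..Real.pi, 2 * (1 - Real.cos t) * trigSq p n t ≤
      2 * Real.pi * (n : ℝ) ^ 3 := by
    simp_rw [← trigSq_sub p n (by simp [hp]) (by simp [hp])]
    rw [integral_trigSq]
    gcongr
    exact sum_parabola_diff_sq n
  have I3 : ∫ t in (-Real.pi)..Real.pi, |t| * trigSq p n t ≤ 50 / n * W := by
    have : ∫ t in (-Real.pi)..Real.pi, |t| * trigSq p n t ≤
        ∫ t in (-Real.pi)..Real.pi, (1 / (2 * n) * trigSq p n t +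
          n * Real.pi ^ 2 / 8 * (2 * (1 - Real.cos t) * trigSq p n t)) := by
      refine intervalIntegral.integral_mono_on (by linarith)
        ((by fun_prop : Continuous _).intervalIntegrable _ _)
        ((by fun_prop : Continuous _).intervalIntegrable _ _) ?_
      intro t ht
      have hc : t ^ 2 ≤ Real.pi ^ 2 / 2 * (1 - Real.cos t) := by
        have := Real.cos_le_one_sub_mul_cos_sq (abs_le.2 ht)
        have h2 : 2 / Real.pi ^ 2 * t ^ 2 ≤ 1 - Real.cos t := by linarith
        calc t ^ 2 = Real.pi ^ 2 / 2 * (2 / Real.pi ^ 2 * t ^ 2) := by field_simp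
          _ ≤ _ := by gcongr
      have hb : |t| ≤ 1 / (2 * n) + n / 2 * t ^ 2 := by
        have e : 1 / (2 * n) + n / 2 * t ^ 2 - |t| = (n * |t| - 1) ^ 2 / (2 * n) := by
          rw [← sq_abs t]; field_simp; ring
        have : 0 ≤ (n * |t| - 1) ^ 2 / (2 * n) := by positivity
        linarith
      have hb' : |t| ≤ 1 / (2 * n) + n / 2 * (Real.pi ^ 2 / 2 * (1 - Real.cos t)) :=
        hb.trans (by gcongr)
      calc _ ≤ _ := mul_le_mul_of_nonneg_right hb' (trigSq_nonneg p n t)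
        _ = _ := by ring
    rw [intervalIntegral.integral_add ((by fun_prop : Continuous _).intervalIntegrable _ _)
        ((by fun_prop : Continuous _).intervalIntegrable _ _),
      intervalIntegral.integral_const_mul, intervalIntegral.integral_const_mul, I1] at this
    refine this.trans ?_
    have h5 : n * Real.pi ^ 2 / 8 *
        (∫ t in (-Real.pi)..Real.pi, 2 * (1 - Real.cos t) * trigSq p n t) ≤
        n * Real.pi ^ 2 / 8 * (2 * Real.pi * (n : ℝ) ^ 3) := by gcongr
    have h6 : Real.pi ^ 2 ≤ 10 := by nlinarith [Real.pi_lt_d2]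
    have h7 : n * Real.pi ^ 2 / 8 * (2 * Real.pi * (n : ℝ) ^ 3) ≤ 49 / n * W := by
      calc n * Real.pi ^ 2 / 8 * (2 * Real.pi * (n : ℝ) ^ 3)
          ≤ n * 10 / 8 * (2 * Real.pi * (n : ℝ) ^ 3) := by gcongr
        _ = 40 / n * (2 * Real.pi * (15 / 16 * (n : ℝ) ^ 5 / 30)) := by field_simp; ring
        _ ≤ 49 / n * W := by rw [hW]; gcongr; norm_num
    have h8 : 1 / (2 * n) * W ≤ 1 / n * W := by
      gcongr; linarith
    have : 50 / n * W = 1 / n * W + 49 / n * W := by ring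
    linarith
  have scale : ∀ t, trigSq (fun j => p j / √W) n t = trigSq p n t / W := by
    intro t
    unfold trigSq
    simp_rw [div_mul_eq_mul_div, ← Finset.sum_div, div_pow, Real.sq_sqrt hW0.le]
    ring
  refine ⟨fun j => p j / √W, ?_, ?_⟩
  · simp_rw [scale]
    rw [intervalIntegral.integral_div, I1, div_self hW0.ne']
  · simp_rw [scale, ← mul_div_assoc]
    rw [intervalIntegral.integral_div, div_le_iff₀ hW0]
    exact I3

theorem integral_even_mul_cos_sub {φ : ℝ → ℝ} (hφ : Continuous φ) (heven : ∀ s, φ (-s) = φ s)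
    (hper : Function.Periodic φ (2 * Real.pi)) (d : ℤ) (θ : ℝ) :
    ∫ t in (-Real.pi)..Real.pi, φ (θ - t) * Real.cos (d * t) =
      (Chebyshev.T ℝ d).eval (Real.cos θ) *
        ∫ s in (-Real.pi)..Real.pi, φ s * Real.cos (d * s) := by
  have hodd : ∫ s in (-Real.pi)..Real.pi, φ s * Real.sin (d * s) = 0 := by
    have h := intervalIntegral.integral_comp_neg (a := -Real.pi) (b := Real.pi)
      (fun s => φ s * Real.sin (d * s))
    simp only [heven, mul_neg, Real.sin_neg, neg_neg, intervalIntegral.integral_neg] at h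
    linarith
  have hG : Function.Periodic (fun s => φ s * Real.cos (d * (θ - s))) (2 * Real.pi) := by
    intro s
    have : (d : ℝ) * (θ - (s + 2 * Real.pi)) = d * (θ - s) - d * (2 * Real.pi) := by ring
    simp only [hper s, this, Real.cos_sub_int_mul_two_pi]
  have h1 := intervalIntegral.integral_comp_sub_left (a := -Real.pi) (b := Real.pi)
    (fun s => φ s * Real.cos (d * (θ - s))) θ
  have h2 := hG.intervalIntegral_add_eq (θ - Real.pi) (-Real.pi)
  simp only [sub_sub_cancel] at h1
  rw [show θ - Real.pi + 2 * Real.pi = θ - -Real.pi by ring,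
    show -Real.pi + 2 * Real.pi = Real.pi by ring] at h2
  rw [h1, h2]
  have h3 : ∀ s, φ s * Real.cos (d * (θ - s)) =
      Real.cos (d * θ) * (φ s * Real.cos (d * s)) +
        Real.sin (d * θ) * (φ s * Real.sin (d * s)) := by
    intro s
    rw [mul_sub, Real.cos_sub]; ring
  simp_rw [h3]
  rw [intervalIntegral.integral_add ((by fun_prop : Continuous _).intervalIntegrable _ _)
      ((by fun_prop : Continuous _).intervalIntegrable _ _),
    intervalIntegral.integral_const_mul, intervalIntegral.integral_const_mul, hodd,
    Chebyshev.T_real_cos]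
  ring

theorem exists_polynomial_integral_trigSq {φ : ℝ → ℝ} (hφ : Continuous φ)
    (heven : ∀ s, φ (-s) = φ s) (hper : Function.Periodic φ (2 * Real.pi))
    (a : ℕ → ℝ) (n : ℕ) :
    ∃ q : ℝ[X], q.natDegree ≤ n ∧ ∀ θ, q.eval (Real.cos θ) =
      ∫ t in (-Real.pi)..Real.pi, φ (θ - t) * trigSq a n t := by
  refine ⟨∑ j ∈ Finset.range n, ∑ l ∈ Finset.range n,
    C (a j * a l * ∫ s in (-Real.pi)..Real.pi, φ s * Real.cos (((j : ℤ) - (l : ℤ) : ℤ) * s)) *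
      Chebyshev.T ℝ ((j : ℤ) - (l : ℤ)), ?_, ?_⟩
  · refine natDegree_sum_le_of_forall_le _ _ fun j hj =>
      natDegree_sum_le_of_forall_le _ _ fun l hl => ?_
    refine (natDegree_C_mul_le _ _).trans ?_
    rw [Chebyshev.natDegree_T]
    rw [Finset.mem_range] at hj hl
    omega
  · intro θ
    simp_rw [trigSq_eq_sum, Finset.mul_sum, eval_finsetSum, eval_mul, eval_C]
    rw [intervalIntegral.integral_finsetSum
      (fun j _ => (by fun_prop : Continuous _).intervalIntegrable _ _)]
    refine Finset.sum_congr rfl fun j hj => ?_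
    rw [intervalIntegral.integral_finsetSum
      (fun j _ => (by fun_prop : Continuous _).intervalIntegrable _ _)]
    refine Finset.sum_congr rfl fun l hl => ?_
    rw [mul_assoc, mul_comm (∫ _ in _.._, _), ← integral_even_mul_cos_sub hφ heven hper,
      ← intervalIntegral.integral_const_mul]
    congr 1; ext t; ring

/-- **Jackson's inequality** for Lipschitz functions on `[-1, 1]`. -/
theorem exists_polynomial_approx_of_lipschitz {f : ℝ → ℝ} {L : ℝ} (hL : 0 ≤ L)
    (hf : ∀ x ∈ Icc (-1 : ℝ) 1, ∀ y ∈ Icc (-1 : ℝ) 1, |f x - f y| ≤ L * |x - y|)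
    (n : ℕ) (hn : 1 ≤ n) :
    ∃ q : ℝ[X], q.natDegree ≤ n ∧ ∀ s ∈ Icc (-1 : ℝ) 1, |q.eval s - f s| ≤ L * (50 / n) := by
  rcases hn.eq_or_lt with rfl | hn
  · refine ⟨C (f 0), by simp, fun s hs => ?_⟩
    rw [eval_C]
    refine (hf 0 (by simp) s hs).trans ?_
    gcongr
    have := abs_le.2 hs
    simp only [zero_sub, abs_neg, Nat.cast_one]
    linarith
  have hfc : ContinuousOn f (Icc (-1) 1) := by
    refine (LipschitzOnWith.of_dist_le_mul (K := L.toNNReal) fun x hx y hy => ?_).continuousOn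
    rw [Real.dist_eq, Real.dist_eq, Real.coe_toNNReal L hL]
    exact hf x hx y hy
  have hmem : ∀ s, Real.cos s ∈ Icc (-1 : ℝ) 1 := fun s => ⟨Real.neg_one_le_cos s, Real.cos_le_one s⟩
  have hφ : Continuous fun s => f (Real.cos s) := hfc.comp_continuous Real.continuous_cos hmem
  obtain ⟨a, ha1, ha2⟩ := exists_kernel n hn
  obtain ⟨q, hq, hqe⟩ := exists_polynomial_integral_trigSq hφ (by simp) (fun s => by simp) a n
  refine ⟨q, hq, fun s hs => ?_⟩
  obtain ⟨θ, rfl⟩ : ∃ θ, Real.cos θ = s := ⟨_, Real.cos_arccos hs.1 hs.2⟩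
  have hc : f (Real.cos θ) =
      ∫ t in (-Real.pi)..Real.pi, f (Real.cos θ) * trigSq a n t := by
    rw [intervalIntegral.integral_const_mul, ha1, mul_one]
  have hφs : Continuous fun t => f (Real.cos (θ - t)) :=
    hφ.comp (continuous_const.sub continuous_id)
  rw [hqe, hc, ← intervalIntegral.integral_sub
    (f := fun t => f (Real.cos (θ - t)) * trigSq a n t)
    ((hφs.mul (continuous_trigSq a n)).intervalIntegrable _ _)
    ((by fun_prop : Continuous _).intervalIntegrable _ _)]
  have hpi : -Real.pi ≤ Real.pi := by linarith [Real.pi_pos]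
  calc _ ≤ ∫ t in (-Real.pi)..Real.pi, L * (|t| * trigSq a n t) := by
        rw [← Real.norm_eq_abs]
        refine intervalIntegral.norm_integral_le_of_norm_le hpi
          (Filter.Eventually.of_forall fun t _ => ?_)
          ((by fun_prop : Continuous _).intervalIntegrable _ _)
        rw [← sub_mul, norm_mul, Real.norm_eq_abs, Real.norm_of_nonneg (trigSq_nonneg _ _ _),
          ← mul_assoc]
        refine mul_le_mul_of_nonneg_right ?_ (trigSq_nonneg _ _ _)
        refine (hf _ (hmem _) _ (hmem _)).trans ?_
        refine mul_le_mul_of_nonneg_left ?_ hL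
        refine (Real.abs_cos_sub_cos_le (θ - t) θ).trans ?_
        simp
    _ ≤ _ := by
        rw [intervalIntegral.integral_const_mul]
        gcongr

theorem exists_antiderivative (q : ℝ[X]) (c : ℝ) :
    ∃ Q : ℝ[X], derivative Q = q ∧ Q.eval (-1) = c ∧ Q.natDegree ≤ q.natDegree + 1 := by
  set P : ℝ[X] := ∑ i ∈ Finset.range (q.natDegree + 1),
    C (q.coeff i / (i + 1)) * X ^ (i + 1) with hP
  have hP' : derivative P = q := by
    conv_rhs => rw [q.as_sum_range_C_mul_X_pow]
    rw [hP, derivative_sum]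
    refine Finset.sum_congr rfl fun i _ => ?_
    have : (i : ℝ) + 1 ≠ 0 := by positivity
    rw [derivative_C_mul_X_pow, Nat.add_sub_cancel]
    push_cast
    rw [div_mul_cancel₀ _ this]
  have hPd : P.natDegree ≤ q.natDegree + 1 := by
    refine natDegree_sum_le_of_forall_le _ _ fun i hi => (natDegree_C_mul_X_pow_le _ _).trans ?_
    rw [Finset.mem_range] at hi
    omega
  exact ⟨P + C (c - P.eval (-1)), by simp [hP'], by simp,
    by rwa [natDegree_add_C]⟩

theorem exists_polynomial_approx_of_contDiffOn (k : ℕ) {f : ℝ → ℝ}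
    (hf : ContDiffOn ℝ k f (Icc (-1 : ℝ) 1)) :
    ∃ A : ℝ, 0 ≤ A ∧ ∀ n : ℕ, 1 ≤ n → ∃ q : ℝ[X], q.natDegree ≤ n + k ∧
      ∀ s ∈ Icc (-1 : ℝ) 1, |q.eval s - f s| ≤ A / n ^ k := by
  induction k generalizing f with
  | zero =>
    obtain ⟨A, hA⟩ := isCompact_Icc.exists_bound_of_continuousOn hf.continuousOn
    refine ⟨A, (norm_nonneg _).trans (hA 0 (by simp)), fun n _ => ⟨0, by simp, fun s hs => ?_⟩⟩
    simpa using hA s hs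
  | succ k ih =>
    have hu : UniqueDiffOn ℝ (Icc (-1 : ℝ) 1) := uniqueDiffOn_Icc (by norm_num)
    have hd : ∀ s ∈ Icc (-1 : ℝ) 1,
        HasDerivWithinAt f (derivWithin f (Icc (-1) 1) s) (Icc (-1) 1) s := fun s hs =>
      (hf.differentiableOn (by simp) s hs).hasDerivWithinAt
    obtain ⟨A, hA0, hA⟩ := ih (hf.derivWithin hu (m := k) (by simp))
    refine ⟨A * 50, by positivity, fun n hn => ?_⟩
    obtain ⟨q, hq, hqe⟩ := hA n hn
    obtain ⟨Q, hQ, -, hQd⟩ := exists_antiderivative q 0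
    obtain ⟨R, hR, hRe⟩ := exists_polynomial_approx_of_lipschitz
      (f := fun s => f s - Q.eval s) (L := A / n ^ k) (by positivity) (fun x hx y hy => by
        have := (convex_Icc (-1 : ℝ) 1).norm_image_sub_le_of_norm_hasDerivWithin_le
          (f := fun s => f s - Q.eval s) (f' := fun s => derivWithin f (Icc (-1) 1) s - q.eval s)
          (C := A / n ^ k)
          (fun s hs => by
            rw [← hQ]
            exact (hd s hs).sub (Q.hasDerivAt s).hasDerivWithinAt)
          (fun s hs => by rw [Real.norm_eq_abs, abs_sub_comm]; exact hqe s hs) hy hx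
        simpa using this) n hn
    refine ⟨Q + R, (natDegree_add_le _ _).trans (by omega), fun s hs => ?_⟩
    have := hRe s hs
    rw [eval_add]
    calc _ = |R.eval s - (f s - Q.eval s)| := by congr 1; ring
      _ ≤ _ := this
      _ = _ := by rw [pow_succ]; field_simp

/-- Repeated integration of a polynomial approximation of `y K` along a chain `(y j)' = y (j + 1)`,
matching the values at `-1`. -/
theorem exists_polynomial_chain (K : ℕ) (y : ℕ → ℝ → ℝ)
    (hy : ∀ j < K, ∀ s ∈ Icc (-1 : ℝ) 1, HasDerivWithinAt (y j) (y (j + 1) s) (Icc (-1) 1) s)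
    (Z : ℝ[X]) (ε : ℝ) (hZ : ∀ s ∈ Icc (-1 : ℝ) 1, |Z.eval s - y K s| ≤ ε) :
    ∃ P : ℕ → ℝ[X], (∀ j < K, derivative (P j) = P (j + 1)) ∧
      (∀ j < K, (P j).eval (-1) = y j (-1)) ∧
      (∀ j ≤ K, (P j).natDegree ≤ Z.natDegree + K) ∧
      ∀ j ≤ K, ∀ s ∈ Icc (-1 : ℝ) 1, |(P j).eval s - y j s| ≤ 2 ^ K * ε := by
  have hε : 0 ≤ ε := (abs_nonneg _).trans (hZ 0 (by simp))
  induction K generalizing y with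
  | zero => exact ⟨fun _ => Z, by simp, by simp, by simp, fun j hj s hs => by
      obtain rfl : j = 0 := by omega
      simpa using hZ s hs⟩
  | succ K ih =>
    obtain ⟨P, h1, h2, h3, h4⟩ := ih (fun j => y (j + 1)) (fun j hj => hy (j + 1) (by omega)) hZ
    obtain ⟨Q, hQ, hQ1, hQd⟩ := exists_antiderivative (P 0) (y 0 (-1))
    have hle : (2 : ℝ) ^ K * ε ≤ 2 ^ (K + 1) * ε := by
      gcongr
      · norm_num
      · omega
    refine ⟨fun j => Nat.casesOn j Q P, ?_, ?_, ?_, ?_⟩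
    · rintro (_ | j) hj
      · exact hQ
      · exact h1 j (by omega)
    · rintro (_ | j) hj
      · exact hQ1
      · exact h2 j (by omega)
    · rintro (_ | j) hj
      · have := h3 0 (by omega)
        show Q.natDegree ≤ _
        omega
      · have := h3 j (by omega)
        show (P j).natDegree ≤ _
        omega
    · rintro (_ | j) hj s hs
      · have := (convex_Icc (-1 : ℝ) 1).norm_image_sub_le_of_norm_hasDerivWithin_le
          (f := fun s => Q.eval s - y 0 s) (f' := fun s => (P 0).eval s - y 1 s)
          (C := 2 ^ K * ε)
          (fun s hs => by
            rw [← hQ]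
            exact (Q.hasDerivAt s).hasDerivWithinAt.sub (hy 0 (by omega) s hs))
          (fun s hs => h4 0 (by omega) s hs) (x := -1) (by simp) hs
        simp only [hQ1, sub_self, sub_zero, Real.norm_eq_abs] at this
        have h5 : |s - -1| ≤ 2 := abs_le.2 ⟨by linarith [hs.1], by linarith [hs.2]⟩
        calc _ ≤ _ := this
          _ ≤ 2 ^ K * ε * 2 := by gcongr
          _ = _ := by ring
      · exact (h4 j (by omega) s hs).trans hle

theorem continuousOn_eq_zero_of_integral_sq {h : ℝ → ℝ} (hc : ContinuousOn h (Icc (-1) 1))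
    (h0 : ∫ s in (-1 : ℝ)..1, h s ^ 2 ≤ 0) : ∀ s ∈ Icc (-1 : ℝ) 1, h s = 0 := by
  intro s hs
  by_contra hne
  have := intervalIntegral.integral_pos (a := -1) (b := 1) (by norm_num) (hc.pow 2)
    (fun x _ => sq_nonneg (h x)) ⟨s, hs, sq_pos_iff.2 hne⟩
  simp only [Pi.pow_apply] at this
  linarith

/-- Jackson's theorem for `C^k` functions on `[-1, 1]`. -/
theorem exists_polynomial_approx_natDegree_le (k : ℕ) {f : ℝ → ℝ}
    (hf : ContDiffOn ℝ k f (Icc (-1 : ℝ) 1)) :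
    ∃ A : ℝ, 0 ≤ A ∧ ∀ n : ℕ, k + 1 ≤ n → ∃ q : ℝ[X], q.natDegree ≤ n ∧
      ∀ s ∈ Icc (-1 : ℝ) 1, |q.eval s - f s| ≤ A / n ^ k := by
  obtain ⟨A, hA0, hA⟩ := exists_polynomial_approx_of_contDiffOn k hf
  refine ⟨A * (k + 1) ^ k, by positivity, fun n hn => ?_⟩
  obtain ⟨q, hq, hqe⟩ := hA (n - k) (by omega)
  refine ⟨q, by omega, fun s hs => (hqe s hs).trans ?_⟩
  have h1 : (1 : ℝ) ≤ (n - k : ℕ) := by exact_mod_cast (by omega : 1 ≤ n - k)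
  have h2 : (n : ℝ) = (n - k : ℕ) + k := by exact_mod_cast (by omega : n = n - k + k)
  have h3 : (n : ℝ) ≤ (k + 1) * (n - k : ℕ) := by
    have : (0 : ℝ) ≤ k := by positivity
    rw [h2]
    nlinarith
  have h0 : (0 : ℝ) < n := by linarith [(Nat.cast_nonneg k : (0 : ℝ) ≤ k)]
  rw [div_le_div_iff₀ (by positivity) (by positivity), mul_assoc, ← mul_pow]
  gcongr

theorem ContDiffOn.contDiffOn_iteratedDerivWithin {I : Set ℝ} (hI : UniqueDiffOn ℝ I) (l k : ℕ)
    {f : ℝ → ℝ} (hf : ContDiffOn ℝ (l + k : ℕ) f I) :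
    ContDiffOn ℝ k (iteratedDerivWithin l f I) I := by
  induction l generalizing f with
  | zero => simpa using hf
  | succ l ih =>
    rw [iteratedDerivWithin_succ']
    refine ih (hf.derivWithin hI ?_)
    exact_mod_cast (by omega : l + k + 1 ≤ l + 1 + k)

/-- Stability of the control `u`, defined by `z = f + g * u`, under perturbations. -/
theorem abs_control_sub_le {z z' a a' b b' u δ γ U Kf Kg : ℝ} (hz : z = a + b * u)
    (hzz : |z' - z| ≤ δ) (ha : |a' - a| ≤ Kf * δ) (hb : |b' - b| ≤ Kg * δ) (hγ : 0 < γ)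
    (hbγ : γ ≤ |b|) (hδ : Kg * δ ≤ γ / 2) (hu : |u| ≤ U) :
    |(z' - a') / b' - u| ≤ (1 + Kf + Kg * U) * (2 / γ) * δ := by
  have hb' : γ / 2 ≤ |b'| := by
    have := abs_sub_abs_le_abs_sub b b'
    rw [abs_sub_comm] at this
    linarith
  have hb0 : b' ≠ 0 := abs_pos.1 (by linarith)
  have e : (z' - a') / b' - u = ((z' - z) - (a' - a) - (b' - b) * u) / b' := by
    rw [hz]; field_simp; ring
  have hbu : |(b' - b) * u| ≤ Kg * δ * U := by
    rw [abs_mul]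
    exact mul_le_mul hb hu (abs_nonneg _) ((abs_nonneg _).trans hb)
  have hnum : |(z' - z) - (a' - a) - (b' - b) * u| ≤ δ + Kf * δ + Kg * δ * U :=
    (abs_sub _ _).trans (add_le_add ((abs_sub _ _).trans (add_le_add hzz ha)) hbu)
  rw [e, abs_div]
  calc _ ≤ (δ + Kf * δ + Kg * δ * U) / (γ / 2) :=
        div_le_div₀ ((abs_nonneg _).trans hnum) hnum (by positivity) hb'
    _ = _ := by field_simp

/-- Polynomial approximation of feasible trajectories of the chained
(feedback-linearizable) system: if `(x,u)` solves the system on `[-1,1]` and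
`x_r^{(m)}` has bounded variation (`m ≥ 2`), then for each `1 ≤ m₁ ≤ m-1` there are
`M, N₁ > 0` such that for every `N ≥ N₁` there is a polynomial solution `(x^N, u^N)`
of the same system, of degree `≤ N`, matching the initial state and approximating
`x`, the derivatives of `x_r` up to order `m₁`, and `u`, with error
`M ‖x_r‖_{W^{m,2}} (N-r-m₁+1)^{-(m-m₁)+3/4}`. -/
theorem stmt14_feasible_approximation
    (r : ℕ) (hr : 0 < r)
    (f g : (Fin r → ℝ) → ℝ)
    (Kf Kg : NNReal) (hf : LipschitzWith Kf f) (hgL : LipschitzWith Kg g)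
    (hg : ∀ y, g y ≠ 0)
    (x : Fin r → ℝ → ℝ) (u : ℝ → ℝ)
    -- `(x,u)` solves the chained system on `[-1,1]`:
    (hsys1 : ∀ (i : Fin r) (hi : (i : ℕ) + 1 < r), ∀ s ∈ Icc (-1 : ℝ) 1,
      HasDerivAt (x i) (x ⟨(i : ℕ) + 1, hi⟩ s) s)
    (hsys2 : ∀ s ∈ Icc (-1 : ℝ) 1,
      HasDerivAt (x ⟨r - 1, Nat.sub_lt hr one_pos⟩)
        (f (fun i => x i s) + g (fun i => x i s) * u s) s)
    (m : ℕ) (hm : 2 ≤ m)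
    (hsmooth : ContDiffOn ℝ m (x ⟨r - 1, Nat.sub_lt hr one_pos⟩) (Icc (-1 : ℝ) 1))
    (hBV : BoundedVariationOn
      (iteratedDerivWithin m (x ⟨r - 1, Nat.sub_lt hr one_pos⟩) (Icc (-1 : ℝ) 1))
      (Icc (-1 : ℝ) 1))
    (m₁ : ℕ) (hm₁ : 1 ≤ m₁) (hm₁m : m₁ ≤ m - 1)
    -- `S` bounds the Sobolev `W^{m,2}` norm of `x_r`:
    (S : ℝ)
    (hS : ∑ j ∈ Finset.range (m + 1),
      Real.sqrt (∫ s in (-1 : ℝ)..1,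
        (iteratedDerivWithin j (x ⟨r - 1, Nat.sub_lt hr one_pos⟩) (Icc (-1 : ℝ) 1) s) ^ 2)
      ≤ S) :
    ∃ (M : ℝ) (N₁ : ℕ), 0 < M ∧ 0 < N₁ ∧ ∀ N : ℕ, N₁ ≤ N →
      ∃ (p : Fin r → Polynomial ℝ) (uN : ℝ → ℝ),
        (∀ i, (p i).natDegree ≤ N) ∧
        (∀ i, (p i).eval (-1) = x i (-1)) ∧
        (∀ (i : Fin r) (hi : (i : ℕ) + 1 < r), ∀ s ∈ Icc (-1 : ℝ) 1,
          (Polynomial.derivative (p i)).eval s = (p ⟨(i : ℕ) + 1, hi⟩).eval s) ∧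
        (∀ s ∈ Icc (-1 : ℝ) 1,
          (Polynomial.derivative (p ⟨r - 1, Nat.sub_lt hr one_pos⟩)).eval s =
            f (fun i => (p i).eval s) + g (fun i => (p i).eval s) * uN s) ∧
        (∀ i, ∀ s ∈ Icc (-1 : ℝ) 1, |(p i).eval s - x i s| ≤
          M * S * ((N : ℝ) - r - m₁ + 1) ^ (-((m : ℝ) - m₁) + 3 / 4 : ℝ)) ∧
        (∀ l, 1 ≤ l → l ≤ m₁ → ∀ s ∈ Icc (-1 : ℝ) 1,
          |(Polynomial.derivative^[l] (p ⟨r - 1, Nat.sub_lt hr one_pos⟩)).eval s -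
            iteratedDerivWithin l (x ⟨r - 1, Nat.sub_lt hr one_pos⟩) (Icc (-1 : ℝ) 1) s| ≤
          M * S * ((N : ℝ) - r - m₁ + 1) ^ (-((m : ℝ) - m₁) + 3 / 4 : ℝ)) ∧
        (∀ s ∈ Icc (-1 : ℝ) 1, |uN s - u s| ≤
          M * S * ((N : ℝ) - r - m₁ + 1) ^ (-((m : ℝ) - m₁) + 3 / 4 : ℝ)) := by
  have hI : UniqueDiffOn ℝ (Icc (-1 : ℝ) 1) := uniqueDiffOn_Icc (by norm_num)
  set last : Fin r := ⟨r - 1, Nat.sub_lt hr one_pos⟩ with hlast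
  set D : ℕ → ℝ → ℝ := fun l => iteratedDerivWithin l (x last) (Icc (-1 : ℝ) 1) with hD
  have hDc : ∀ l ≤ m, ContinuousOn (D l) (Icc (-1) 1) := fun l hl =>
    hsmooth.continuousOn_iteratedDerivWithin (by exact_mod_cast hl) hI
  have hDd : ∀ l < m, ∀ s ∈ Icc (-1 : ℝ) 1,
      HasDerivWithinAt (D l) (D (l + 1) s) (Icc (-1) 1) s := fun l hl s hs => by
    simp only [hD, iteratedDerivWithin_succ]
    exact (hsmooth.differentiableOn_iteratedDerivWithin (by exact_mod_cast hl) hI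
      s hs).hasDerivWithinAt
  have hD1 : ∀ s ∈ Icc (-1 : ℝ) 1, D 1 s = f (fun i => x i s) + g (fun i => x i s) * u s := by
    intro s hs
    simp only [hD, iteratedDerivWithin_one]
    exact (hsys2 s hs).hasDerivWithinAt.derivWithin (hI s hs)
  have hxder : ∀ i, ∀ s ∈ Icc (-1 : ℝ) 1, ContinuousAt (x i) s := by
    intro i s hs
    by_cases hi : (i : ℕ) + 1 < r
    · exact (hsys1 i hi s hs).continuousAt
    · have : i = last := Fin.ext (by simp only [hlast]; omega)
      rw [this]
      exact (hsys2 s hs).continuousAt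
  have hxc : ContinuousOn (fun s i => x i s) (Icc (-1 : ℝ) 1) :=
    continuousOn_pi.2 fun i s hs => (hxder i s hs).continuousWithinAt
  have hgc : ContinuousOn (fun s => g (fun i => x i s)) (Icc (-1 : ℝ) 1) :=
    hgL.continuous.comp_continuousOn hxc
  have hfc : ContinuousOn (fun s => f (fun i => x i s)) (Icc (-1 : ℝ) 1) :=
    hf.continuous.comp_continuousOn hxc
  obtain ⟨γ, hγ, hγg⟩ : ∃ γ : ℝ, 0 < γ ∧ ∀ s ∈ Icc (-1 : ℝ) 1, γ ≤ |g (fun i => x i s)| := by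
    obtain ⟨s₀, -, h₀⟩ := isCompact_Icc.exists_isMinOn (nonempty_Icc.2 (by norm_num)) hgc.abs
    exact ⟨_, abs_pos.2 (hg fun i => x i s₀), fun s hs => h₀ hs⟩
  obtain ⟨U, hU⟩ : ∃ U, ∀ s ∈ Icc (-1 : ℝ) 1, |u s| ≤ U := by
    have huc : ContinuousOn (fun s => (D 1 s - f (fun i => x i s)) / g (fun i => x i s))
        (Icc (-1 : ℝ) 1) := ((hDc 1 (by omega)).sub hfc).div hgc fun s _ => hg _
    obtain ⟨U, hU⟩ := isCompact_Icc.exists_bound_of_continuousOn huc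
    refine ⟨U, fun s hs => ?_⟩
    have h := hU s hs
    rwa [hD1 s hs, add_sub_cancel_left, mul_div_cancel_left₀ _ (hg _)] at h
  have hU0 : 0 ≤ U := (abs_nonneg _).trans (hU 0 (by simp))
  set y : ℕ → ℝ → ℝ := fun j => if h : j < r - 1 then x ⟨j, by omega⟩ else D (j - (r - 1)) with hy
  have hyx : ∀ i : Fin r, y i = x i := by
    intro i
    by_cases h : (i : ℕ) < r - 1
    · simp [hy, h]
    · have : i = last := Fin.ext (by simp only [hlast]; omega)
      subst this
      simp [hy, hD, hlast, iteratedDerivWithin_zero]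
  have hyD : ∀ l, y (r - 1 + l) = D l := by intro l; simp [hy]
  set K := r - 1 + m₁ with hK
  have hchain : ∀ j < K, ∀ s ∈ Icc (-1 : ℝ) 1,
      HasDerivWithinAt (y j) (y (j + 1) s) (Icc (-1) 1) s := by
    intro j hj s hs
    by_cases h : j + 1 < r
    · have := (hsys1 ⟨j, by omega⟩ h s hs).hasDerivWithinAt (s := Icc (-1 : ℝ) 1)
      rwa [← hyx, ← hyx] at this
    · obtain ⟨l, rfl⟩ := Nat.exists_eq_add_of_le (by omega : r - 1 ≤ j)
      rw [add_assoc, hyD, hyD]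
      exact hDd l (by omega) s hs
  set B : ℝ := 2 ^ K * (1 + (1 + Kf + Kg * U) * (2 / γ)) with hB
  have hB2 : (2 : ℝ) ^ K ≤ B := by
    rw [hB]
    refine le_mul_of_one_le_right (by positivity) ?_
    have : 0 ≤ (1 + Kf + Kg * U) * (2 / γ) := by positivity
    linarith
  have hB0 : 0 < B := lt_of_lt_of_le (by positivity) hB2
  have feasible : ∀ (N : ℕ) (Z : ℝ[X]) (ε : ℝ), Z.natDegree + K ≤ N →
      (∀ s ∈ Icc (-1 : ℝ) 1, |Z.eval s - D m₁ s| ≤ ε) → Kg * (2 ^ K * ε) ≤ γ / 2 →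
      ∃ (p : Fin r → Polynomial ℝ) (uN : ℝ → ℝ),
        (∀ i, (p i).natDegree ≤ N) ∧
        (∀ i, (p i).eval (-1) = x i (-1)) ∧
        (∀ (i : Fin r) (hi : (i : ℕ) + 1 < r), ∀ s ∈ Icc (-1 : ℝ) 1,
          (Polynomial.derivative (p i)).eval s = (p ⟨(i : ℕ) + 1, hi⟩).eval s) ∧
        (∀ s ∈ Icc (-1 : ℝ) 1, (Polynomial.derivative (p last)).eval s =
            f (fun i => (p i).eval s) + g (fun i => (p i).eval s) * uN s) ∧
        (∀ i, ∀ s ∈ Icc (-1 : ℝ) 1, |(p i).eval s - x i s| ≤ B * ε) ∧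
        (∀ l, 1 ≤ l → l ≤ m₁ → ∀ s ∈ Icc (-1 : ℝ) 1,
          |(Polynomial.derivative^[l] (p last)).eval s - D l s| ≤ B * ε) ∧
        (∀ s ∈ Icc (-1 : ℝ) 1, |uN s - u s| ≤ B * ε) := by
    intro N Z ε hN hZ hsmall
    have hε : 0 ≤ ε := (abs_nonneg _).trans (hZ 0 (by simp))
    obtain ⟨P, hP1, hP2, hP3, hP4⟩ := exists_polynomial_chain K y hchain Z ε
      (by rw [hK, hyD]; exact hZ)
    have hiK : ∀ i : Fin r, (i : ℕ) < K := fun i => by omega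
    have hder : ∀ l ≤ m₁, derivative^[l] (P (r - 1)) = P (r - 1 + l) := by
      intro l
      induction l with
      | zero => simp
      | succ l ih =>
        intro hl
        rw [Function.iterate_succ_apply', ih (by omega), hP1 _ (by omega), add_assoc]
    have herr : ∀ (i : Fin r), ∀ s ∈ Icc (-1 : ℝ) 1, |(P i).eval s - x i s| ≤ 2 ^ K * ε := by
      intro i s hs
      rw [← hyx]
      exact hP4 i (hiK i).le s hs
    have hderr : ∀ l ≤ m₁, ∀ s ∈ Icc (-1 : ℝ) 1,
        |(derivative^[l] (P (r - 1))).eval s - D l s| ≤ 2 ^ K * ε := by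
      intro l hl s hs
      rw [hder l hl, ← hyD]
      exact hP4 _ (by omega) s hs
    have hle : 2 ^ K * ε ≤ B * ε := mul_le_mul_of_nonneg_right hB2 hε
    have hdist : ∀ s ∈ Icc (-1 : ℝ) 1,
        dist (fun i : Fin r => (P i).eval s) (fun i => x i s) ≤ 2 ^ K * ε := fun s hs =>
      (dist_pi_le_iff (by positivity)).2 fun i => herr i s hs
    refine ⟨fun i => P i, fun s => ((derivative (P (r - 1))).eval s -
      f (fun i => (P i).eval s)) / g (fun i => (P i).eval s), fun i => (hP3 i (hiK i).le).trans hN,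
      fun i => (hP2 i (hiK i)).trans (by rw [hyx]), fun i hi s hs => by rw [hP1 i (hiK i)],
      fun s hs => ?_, fun i s hs => (herr i s hs).trans hle,
      fun l _ hl s hs => (hderr l hl s hs).trans hle, fun s hs => ?_⟩
    · rw [mul_div_cancel₀ _ (hg _)]
      ring
    · refine (abs_control_sub_le (hD1 s hs) (hderr 1 hm₁ s hs)
        ((hf.dist_le_mul _ _).trans (mul_le_mul_of_nonneg_left (hdist s hs) Kf.2))
        ((hgL.dist_le_mul _ _).trans (mul_le_mul_of_nonneg_left (hdist s hs) Kg.2))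
        hγ (hγg s hs) hsmall (hU s hs)).trans ?_
      rw [hB, mul_assoc ((2 : ℝ) ^ K), mul_comm _ (2 ^ K * ε), mul_assoc ((2 : ℝ) ^ K),
        mul_comm ε]
      gcongr
      linarith
  clear_value B
  have hS0 : 0 ≤ S := (Finset.sum_nonneg fun j _ => Real.sqrt_nonneg _).trans hS
  rcases hS0.eq_or_lt with rfl | hSpos
  · have hzero : ∀ s ∈ Icc (-1 : ℝ) 1, D m₁ s = 0 := by
      refine continuousOn_eq_zero_of_integral_sq (hDc m₁ (by omega)) (Real.sqrt_eq_zero'.1 ?_)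
      refine le_antisymm (le_trans ?_ hS) (Real.sqrt_nonneg _)
      exact Finset.single_le_sum
        (f := fun j => Real.sqrt (∫ s in (-1 : ℝ)..1, (D j s) ^ 2))
        (fun j _ => Real.sqrt_nonneg _) (Finset.mem_range.2 (by omega))
    refine ⟨1, K + 1, one_pos, by omega, fun N hN => ?_⟩
    have := feasible N 0 0 (by simp; omega) (fun s hs => by simp [hzero s hs])
      (by simp only [mul_zero]; positivity)
    simpa only [mul_zero, zero_mul] using this
  · obtain ⟨k, hk⟩ := Nat.exists_eq_add_of_le (by omega : m₁ ≤ m)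
    obtain ⟨A, hA0, hA⟩ := exists_polynomial_approx_natDegree_le k
      (ContDiffOn.contDiffOn_iteratedDerivWithin hI m₁ k (hk ▸ hsmooth))
    obtain ⟨n₀, hn₀⟩ := exists_nat_ge (Kg * 2 ^ K * A * (2 / γ))
    refine ⟨B * (A + 1) / S, K + k + 1 + n₀, by positivity, by omega, fun N hN => ?_⟩
    obtain ⟨n, rfl⟩ := Nat.exists_eq_add_of_le (by omega : K ≤ N)
    have hn1 : (1 : ℝ) ≤ n := by exact_mod_cast (by omega : 1 ≤ n)
    have hn0 : (n₀ : ℝ) ≤ n := by exact_mod_cast (by omega : n₀ ≤ n)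
    have hncast : ((K + n : ℕ) : ℝ) - r - m₁ + 1 = n := by
      have : ((K + n : ℕ) : ℝ) + 1 = r + m₁ + n := by
        exact_mod_cast (by omega : K + n + 1 = r + m₁ + n)
      linarith
    have hkcast : (m : ℝ) - m₁ = k := by rw [hk]; push_cast; ring
    obtain ⟨q, hq, hqe⟩ := hA n (by omega)
    have hAn : A / (n : ℝ) ^ k ≤ A / n := by
      gcongr
      exact le_self_pow₀ hn1 (by omega)
    have hsmall : Kg * (2 ^ K * (A / (n : ℝ) ^ k)) ≤ γ / 2 := by
      calc (Kg : ℝ) * (2 ^ K * (A / (n : ℝ) ^ k)) ≤ Kg * (2 ^ K * (A / n)) := by gcongr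
        _ = Kg * 2 ^ K * A * (2 / γ) / n * (γ / 2) := by field_simp
        _ ≤ 1 * (γ / 2) := by
          gcongr
          rw [div_le_one (by linarith)]
          exact hn₀.trans hn0
        _ = _ := one_mul _
    have hfinal : B * (A / (n : ℝ) ^ k) ≤ B * (A + 1) / S * S *
        (((K + n : ℕ) : ℝ) - r - m₁ + 1) ^ (-((m : ℝ) - m₁) + 3 / 4 : ℝ) := by
      rw [hncast, hkcast, div_mul_cancel₀ _ hSpos.ne', mul_assoc]
      have h1 : ((n : ℝ) ^ k)⁻¹ ≤ (n : ℝ) ^ (-(k : ℝ) + 3 / 4) := by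
        rw [← Real.rpow_natCast, ← Real.rpow_neg (by linarith)]
        exact Real.rpow_le_rpow_of_exponent_le hn1 (by linarith)
      rw [div_eq_mul_inv]
      exact mul_le_mul_of_nonneg_left
        (mul_le_mul (by linarith) h1 (by positivity) (by positivity)) hB0.le
    obtain ⟨p, uN, h1, h2, h3, h4, h5, h6, h7⟩ := feasible (K + n) q _ (by omega) hqe hsmall
    exact ⟨p, uN, h1, h2, h3, h4, fun i s hs => (h5 i s hs).trans hfinal,
      fun l hl hl' s hs => (h6 l hl hl' s hs).trans hfinal, fun s hs => (h7 s hs).trans hfinal⟩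
end
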